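/- If a sequent Γ ⇒ Δ is derivable in the sequent calculus Go_Seq extended with the cut rule, then Γ ⇒ Δ is derivable in Go_Seq (without cut). -/

import Mathlib

inductive Formula : Type
  | atom : ℕ → Formula
  | bot  : Formula
  | imp  : Formula → Formula → Formula
  | box  : Formula → Formula
deriving DecidableEq

def boxtimes (Γ : Multiset Formula) : Multiset Formula := Γ + Γ.map Formula.box

inductive GoSeq : Bool → Multiset Formula → Multiset Formula → Prop
  | ax (c) (Γ Δ : Multiset Formula) (A : Formula) : GoSeq c (A ::ₘ Γ) (A ::ₘ Δ)
  | axBot (c) (Γ Δ : Multiset Formula) : GoSeq c (Formula.bot ::ₘ Γ) Δ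
  | impL (c) (Γ Δ : Multiset Formula) (A B : Formula) :
      GoSeq c (B ::ₘ Γ) Δ → GoSeq c Γ (A ::ₘ Δ) → GoSeq c ((A.imp B) ::ₘ Γ) Δ
  | impR (c) (Γ Δ : Multiset Formula) (A B : Formula) :
      GoSeq c (A ::ₘ Γ) (B ::ₘ Δ) → GoSeq c Γ ((A.imp B) ::ₘ Δ)
  | boxGo (c) (Γ Δ Θ : Multiset Formula) (A : Formula) :
      GoSeq c ((Formula.box (A.imp (Formula.box A))) ::ₘ boxtimes Θ) {A} →
      GoSeq c (Γ + Θ.map Formula.box) ((Formula.box A) ::ₘ Δ)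
  | cut (Γ Δ : Multiset Formula) (A : Formula) :
      GoSeq true Γ (A ::ₘ Δ) → GoSeq true (A ::ₘ Γ) Δ → GoSeq true Γ Δ


namespace Formula

/-- Truth at a world of the Kripke model with accessibility relation `R` and valuation `V`. -/
def Forces {W : Type} (R : W → W → Prop) (V : W → ℕ → Prop) : W → Formula → Prop
  | w, atom p => V w p
  | _, bot => False
  | w, imp A B => Forces R V w A → Forces R V w B
  | w, box A => ∀ v, R w v → Forces R V v A

/-- The number of implications that are not in the scope of a box. -/
def impCount : Formula → ℕ
  | imp A B => impCount A + impCount B + 1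
  | _ => 0

def IsImp : Formula → Prop
  | imp _ _ => True
  | _ => False

def unbox : Formula → Option Formula
  | box A => some A
  | _ => none

def subformulas : Formula → Finset Formula
  | atom p => {atom p}
  | bot => {bot}
  | imp A B => insert (imp A B) (subformulas A ∪ subformulas B)
  | box A => insert (box A) (subformulas A)

theorem self_mem_subformulas (A : Formula) : A ∈ A.subformulas := by
  cases A <;> simp [subformulas]

theorem subformulas_subset {A B : Formula} (h : A ∈ B.subformulas) :
    A.subformulas ⊆ B.subformulas := by
  induction B with
  | atom p => simp only [subformulas, Finset.mem_singleton] at h; subst h; rfl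
  | bot => simp only [subformulas, Finset.mem_singleton] at h; subst h; rfl
  | imp C D ihC ihD =>
    simp only [subformulas, Finset.mem_insert, Finset.mem_union] at h
    rcases h with rfl | h | h
    · rfl
    · exact (ihC h).trans fun x hx => by simp [subformulas, hx]
    · exact (ihD h).trans fun x hx => by simp [subformulas, hx]
  | box C ih =>
    simp only [subformulas, Finset.mem_insert] at h
    rcases h with rfl | h
    · rfl
    · exact (ih h).trans fun x hx => by simp [subformulas, hx]

end Formula

open Formula

theorem exists_multiset_eq_add_map_box (M : Multiset Formula) :
    ∃ Γ, M = Γ + (M.filterMap unbox).map box := by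
  induction M using Multiset.induction with
  | empty => exact ⟨0, by simp⟩
  | cons A M ih =>
    obtain ⟨Γ, hΓ⟩ := ih
    cases hA : unbox A with
    | none =>
      exact ⟨A ::ₘ Γ, by rw [Multiset.filterMap_cons_none _ _ hA, Multiset.cons_add, ← hΓ]⟩
    | some B =>
      have hAB : A = box B := by cases A <;> simp_all [unbox]
      refine ⟨Γ, ?_⟩
      rw [Multiset.filterMap_cons_some unbox A M hA, Multiset.map_cons, Multiset.add_cons, ← hΓ,
        hAB]

theorem mem_filterMap_unbox {M : Multiset Formula} {A : Formula} :
    A ∈ M.filterMap unbox ↔ box A ∈ M := by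
  rw [Multiset.mem_filterMap]
  constructor
  · rintro ⟨B, hB, h⟩
    cases B <;> simp_all [unbox]
  · exact fun h => ⟨_, h, rfl⟩

theorem GoSeq.sound {W : Type} [Finite W] {R : W → W → Prop}
    (htrans : ∀ u v w, R u v → R v w → R u w) (hanti : ∀ u v, R u v → R v u → u = v)
    (V : W → ℕ → Prop) {c : Bool} {Γ Δ : Multiset Formula} (h : GoSeq c Γ Δ) :
    ∀ w, (∀ A ∈ Γ, Forces R V w A) → ∃ B ∈ Δ, Forces R V w B := by
  induction h with
  | ax c Γ Δ A => exact fun w hw => ⟨A, by simp, hw A (by simp)⟩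
  | axBot c Γ Δ => exact fun w hw => (hw bot (by simp)).elim
  | impL c Γ Δ A B _ _ ih₁ ih₂ =>
    intro w hw
    simp only [Multiset.mem_cons, forall_eq_or_imp, exists_eq_or_imp] at hw ih₁ ih₂
    rcases ih₂ w hw.2 with hA | h
    · exact ih₁ w ⟨hw.1 hA, hw.2⟩
    · exact h
  | impR c Γ Δ A B _ ih =>
    intro w hw
    simp only [Multiset.mem_cons, forall_eq_or_imp, exists_eq_or_imp] at hw ih ⊢
    by_cases hA : Forces R V w A
    · exact (ih w ⟨hA, hw⟩).imp_left fun hB _ => hB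
    · exact Or.inl fun h => absurd h hA
  | boxGo c Γ Δ Θ A _ ih =>
    intro w hw
    refine ⟨box A, by simp, ?_⟩
    by_contra hbox
    have hΘ : ∀ B ∈ Θ, Forces R V w (box B) := fun B hB =>
      hw _ (Multiset.mem_add.2 (Or.inr (Multiset.mem_map_of_mem _ hB)))
    obtain ⟨x, hwx, hx⟩ : ∃ v, R w v ∧ ¬ Forces R V v A := by
      simpa [Forces] using hbox
    let S : W → W → Prop := fun u v => R v u ∧ u ≠ v
    have : IsTrans W S := ⟨fun a b d hab hbd =>
      ⟨htrans _ _ _ hbd.1 hab.1, fun e => by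
        subst e
        exact hab.2 (hanti _ _ hbd.1 hab.1)⟩⟩
    have : Std.Irrefl S := ⟨fun a ha => ha.2 rfl⟩
    obtain ⟨y, ⟨hwy, hy⟩, hmax⟩ :=
      (Finite.wellFounded_of_trans_of_irrefl S).has_min {v | R w v ∧ ¬ Forces R V v A}
        ⟨x, hwx, hx⟩
    have above : ∀ z, R y z → z ≠ y → Forces R V z A := fun z hyz hne => by
      by_contra hz
      exact hmax z ⟨htrans _ _ _ hwy hyz, hz⟩ ⟨hyz, hne⟩
    obtain ⟨B, hB, hyB⟩ := ih y (by
      intro B hB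
      simp only [boxtimes, Multiset.mem_cons, Multiset.mem_add, Multiset.mem_map] at hB
      rcases hB with rfl | hB | ⟨D, hD, rfl⟩
      · intro z hyz hzA v hzv
        refine above v (htrans _ _ _ hyz hzv) ?_
        rintro rfl
        exact hy (hanti _ _ hyz hzv ▸ hzA)
      · exact hΘ B hB y hwy
      · exact fun z hyz => hΘ D hD z (htrans _ _ _ hwy hyz))
    rw [Multiset.mem_singleton] at hB
    exact hy (hB ▸ hyB)
  | cut Γ Δ A _ _ ih₁ ih₂ =>
    intro w hw
    simp only [Multiset.mem_cons, forall_eq_or_imp, exists_eq_or_imp] at ih₁ ih₂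
    exact (ih₁ w hw).elim (fun hA => ih₂ w ⟨hA, hw⟩) id

/-- `L` and `R` bound the formulas occurring on the left, resp. right, in a backward proof
search. -/
structure SearchClosed (L R : Finset Formula) : Prop where
  subset : R ⊆ L
  left_imp : ∀ {A B}, imp A B ∈ L → A ∈ R ∧ B ∈ L
  right_imp : ∀ {A B}, imp A B ∈ R → A ∈ R ∧ B ∈ R
  left_box : ∀ {A}, box A ∈ L → A ∈ L
  right_box : ∀ {A}, box A ∈ R → A ∈ R ∧ box (imp A (box A)) ∈ L

theorem exists_searchClosed (S : Finset Formula) : ∃ L R, SearchClosed L R ∧ S ⊆ R := by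
  let R := S.biUnion subformulas
  have sub : ∀ {A B}, B ∈ R → A ∈ B.subformulas → A ∈ R := fun {A B} hB hA => by
    obtain ⟨D, hD, hBD⟩ := Finset.mem_biUnion.1 hB
    exact Finset.mem_biUnion.2 ⟨D, hD, subformulas_subset hBD hA⟩
  have imp_mem : ∀ {A B}, imp A B ∈ R → A ∈ R ∧ B ∈ R := fun h =>
    ⟨sub h (by simp [subformulas, self_mem_subformulas]),
      sub h (by simp [subformulas, self_mem_subformulas])⟩
  have box_mem : ∀ {A}, box A ∈ R → A ∈ R := fun h =>
    sub h (by simp [subformulas, self_mem_subformulas])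
  let T := R.biUnion fun B => match B with
    | box A => {imp A (box A), box (imp A (box A))}
    | _ => ∅
  have mem_T : ∀ {B}, B ∈ T ↔ ∃ A, box A ∈ R ∧ (B = imp A (box A) ∨ B = box (imp A (box A))) := by
    intro B
    simp only [T, Finset.mem_biUnion]
    constructor
    · rintro ⟨D, hD, hB⟩
      cases D <;> simp at hB
      exact ⟨_, hD, hB⟩
    · rintro ⟨A, hA, hB⟩
      exact ⟨_, hA, by simpa using hB⟩
  refine ⟨R ∪ T, R, ⟨Finset.subset_union_left, ?_, imp_mem, ?_, ?_⟩, fun A hA =>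
    Finset.mem_biUnion.2 ⟨A, hA, self_mem_subformulas A⟩⟩
  · intro A B h
    rcases Finset.mem_union.1 h with h | h
    · exact ⟨(imp_mem h).1, Finset.mem_union_left _ (imp_mem h).2⟩
    · obtain ⟨D, hD, h | h⟩ := mem_T.1 h
      · obtain ⟨rfl, rfl⟩ := Formula.imp.inj h
        exact ⟨box_mem hD, Finset.mem_union_left _ hD⟩
      · cases h
  · intro A h
    rcases Finset.mem_union.1 h with h | h
    · exact Finset.mem_union_left _ (box_mem h)
    · obtain ⟨D, hD, h | h⟩ := mem_T.1 h
      · cases h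
      · obtain rfl := Formula.box.inj h
        exact Finset.mem_union_right _ (mem_T.2 ⟨D, hD, Or.inl rfl⟩)
  · exact fun {A} h => ⟨box_mem h, Finset.mem_union_right _ (mem_T.2 ⟨A, h, Or.inr rfl⟩)⟩

/-- A pair of sets of formulas closed under backward application of the implication rules, whose
formulas other than implications are contained in a sequent without cut-free derivation. -/
structure Saturated (L R : Finset Formula) : Prop where
  left_imp : ∀ {A B}, imp A B ∈ L → B ∈ L ∨ A ∈ R
  right_imp : ∀ {A B}, imp A B ∈ R → A ∈ L ∧ B ∈ R
  underivable : ∃ M N : Multiset Formula, ¬ GoSeq false M N ∧ (∀ A ∈ M, A ∈ L) ∧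
    (∀ A ∈ L, ¬ A.IsImp → A ∈ M) ∧ (∀ A ∈ R, ¬ A.IsImp → A ∈ N)

theorem Saturated.insert_left {L R : Finset Formula} (h : Saturated L R) {A B : Formula}
    (hAB : B ∈ L ∨ A ∈ R) : Saturated (insert (imp A B) L) R := by
  obtain ⟨M, N, hMN, hML, hLM, hRN⟩ := h.underivable
  refine ⟨fun {C D} hCD => ?_, fun hCD => ?_, M, N, hMN,
    fun C hC => Finset.mem_insert_of_mem (hML C hC), fun C hC hi => ?_, hRN⟩
  · rcases Finset.mem_insert.1 hCD with e | hCD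
    · obtain ⟨rfl, rfl⟩ := Formula.imp.inj e
      exact hAB.imp_left Finset.mem_insert_of_mem
    · exact (h.left_imp hCD).imp_left Finset.mem_insert_of_mem
  · exact (h.right_imp hCD).imp_left Finset.mem_insert_of_mem
  · rcases Finset.mem_insert.1 hC with rfl | hC
    · exact (hi trivial).elim
    · exact hLM C hC hi

theorem Saturated.insert_right {L R : Finset Formula} (h : Saturated L R) {A B : Formula}
    (hA : A ∈ L) (hB : B ∈ R) : Saturated L (insert (imp A B) R) := by
  obtain ⟨M, N, hMN, hML, hLM, hRN⟩ := h.underivable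
  refine ⟨fun hCD => (h.left_imp hCD).imp_right Finset.mem_insert_of_mem,
    fun {C D} hCD => ?_, M, N, hMN, hML, hLM, fun C hC hi => ?_⟩
  · rcases Finset.mem_insert.1 hCD with e | hCD
    · obtain ⟨rfl, rfl⟩ := Formula.imp.inj e
      exact ⟨hA, Finset.mem_insert_of_mem hB⟩
    · exact (h.right_imp hCD).imp_right Finset.mem_insert_of_mem
  · rcases Finset.mem_insert.1 hC with rfl | hC
    · exact (hi trivial).elim
    · exact hRN C hC hi

theorem exists_saturated {CL CR : Finset Formula} (hC : SearchClosed CL CR)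
    (Γ Δ : Multiset Formula) (h : ¬ GoSeq false Γ Δ)
    (hΓ : ∀ A ∈ Γ, A ∈ CL) (hΔ : ∀ A ∈ Δ, A ∈ CR) :
    ∃ L R, Saturated L R ∧ L ⊆ CL ∧ R ⊆ CR ∧ (∀ A ∈ Γ, A ∈ L) ∧ (∀ A ∈ Δ, A ∈ R) := by
  induction hn : (Γ.map impCount).sum + (Δ.map impCount).sum using Nat.strong_induction_on
    generalizing Γ Δ with
  | _ n ih =>
  by_cases hl : ∃ A B, imp A B ∈ Γ
  · obtain ⟨A, B, hAB⟩ := hl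
    obtain ⟨Γ, rfl⟩ := Multiset.exists_cons_of_mem hAB
    have hAB' := hΓ _ hAB
    simp only [Multiset.mem_cons, forall_eq_or_imp] at hΓ ⊢
    simp only [Multiset.map_cons, Multiset.sum_cons, impCount] at hn
    by_cases h₁ : GoSeq false (B ::ₘ Γ) Δ
    · have h₂ : ¬ GoSeq false Γ (A ::ₘ Δ) := fun h₂ => h (.impL _ _ _ _ _ h₁ h₂)
      obtain ⟨L, R, hs, hL, hR, hΓL, hΔR⟩ := ih _ (by
        rw [← hn, Multiset.map_cons, Multiset.sum_cons]; omega) Γ (A ::ₘ Δ) h₂ hΓ.2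
        (by simpa using ⟨(hC.left_imp hAB').1, hΔ⟩) rfl
      simp only [Multiset.mem_cons, forall_eq_or_imp] at hΔR
      exact ⟨_, R, hs.insert_left (Or.inr hΔR.1), Finset.insert_subset hAB' hL, hR,
        ⟨Finset.mem_insert_self _ _, fun D hD => Finset.mem_insert_of_mem (hΓL D hD)⟩, hΔR.2⟩
    · obtain ⟨L, R, hs, hL, hR, hΓL, hΔR⟩ := ih _ (by
        rw [← hn, Multiset.map_cons, Multiset.sum_cons]; omega) (B ::ₘ Γ) Δ h₁
        (by simpa using ⟨(hC.left_imp hAB').2, hΓ.2⟩) hΔ rfl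
      simp only [Multiset.mem_cons, forall_eq_or_imp] at hΓL
      exact ⟨_, R, hs.insert_left (Or.inl hΓL.1), Finset.insert_subset hAB' hL, hR,
        ⟨Finset.mem_insert_self _ _, fun D hD => Finset.mem_insert_of_mem (hΓL.2 D hD)⟩, hΔR⟩
  by_cases hr : ∃ A B, imp A B ∈ Δ
  · obtain ⟨A, B, hAB⟩ := hr
    obtain ⟨Δ, rfl⟩ := Multiset.exists_cons_of_mem hAB
    have hAB' := hΔ _ hAB
    simp only [Multiset.mem_cons, forall_eq_or_imp] at hΔ ⊢
    simp only [Multiset.map_cons, Multiset.sum_cons, impCount] at hn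
    obtain ⟨L, R, hs, hL, hR, hΓL, hΔR⟩ := ih _ (by
      rw [← hn, Multiset.map_cons, Multiset.sum_cons, Multiset.map_cons, Multiset.sum_cons]
      omega) (A ::ₘ Γ) (B ::ₘ Δ)
      (fun h' => h (.impR _ _ _ _ _ h'))
      (by simpa using ⟨hC.subset (hC.right_imp hAB').1, hΓ⟩)
      (by simpa using ⟨(hC.right_imp hAB').2, hΔ.2⟩) rfl
    simp only [Multiset.mem_cons, forall_eq_or_imp] at hΓL hΔR
    exact ⟨L, _, hs.insert_right hΓL.1 hΔR.1, hL, Finset.insert_subset hAB' hR, hΓL.2,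
      Finset.mem_insert_self _ _, fun D hD => Finset.mem_insert_of_mem (hΔR.2 D hD)⟩
  · refine ⟨Γ.toFinset, Δ.toFinset, ⟨fun h' => ?_, fun h' => ?_, Γ, Δ, h, ?_, ?_, ?_⟩, ?_, ?_,
      ?_, ?_⟩
    · exact (hl ⟨_, _, Multiset.mem_toFinset.1 h'⟩).elim
    · exact (hr ⟨_, _, Multiset.mem_toFinset.1 h'⟩).elim
    all_goals simp +contextual [Finset.subset_iff, hΓ, hΔ]

theorem GoSeq.ax_of_mem {c : Bool} {Γ Δ : Multiset Formula} {A : Formula} (hΓ : A ∈ Γ)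
    (hΔ : A ∈ Δ) : GoSeq c Γ Δ := by
  obtain ⟨Γ, rfl⟩ := Multiset.exists_cons_of_mem hΓ
  obtain ⟨Δ, rfl⟩ := Multiset.exists_cons_of_mem hΔ
  exact .ax _ _ _ _

theorem Saturated.not_mem_right {L R : Finset Formula} (h : Saturated L R) {A : Formula}
    (hA : ¬ A.IsImp) (hL : A ∈ L) : A ∉ R := by
  obtain ⟨M, N, hMN, -, hLM, hRN⟩ := h.underivable
  exact fun hR => hMN (.ax_of_mem (hLM A hL hA) (hRN A hR hA))

theorem Saturated.bot_not_mem {L R : Finset Formula} (h : Saturated L R) : bot ∉ L := by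
  obtain ⟨M, N, hMN, -, hLM, -⟩ := h.underivable
  intro hL
  obtain ⟨M, rfl⟩ := Multiset.exists_cons_of_mem (hLM _ hL id)
  exact hMN (.axBot _ _ _)

/-- The worlds of the canonical countermodel over bounding sets `CL` and `CR`. -/
abbrev World (CL CR : Finset Formula) : Type :=
  {p : CL.powerset × CR.powerset // Saturated p.1.1 p.2.1}

namespace World

variable {CL CR : Finset Formula}

def left (w : World CL CR) : Finset Formula := w.1.1.1

def right (w : World CL CR) : Finset Formula := w.1.2.1

theorem saturated (w : World CL CR) : Saturated w.left w.right := w.2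

/-- Accessibility: apart from itself, a world that contains the content of each of its own boxed
formulas sees only worlds with strictly more boxed formulas. -/
def Rel (w v : World CL CR) : Prop :=
  (∀ A, box A ∈ w.left → box A ∈ v.left ∧ A ∈ v.left) ∧
    ((∀ A, box A ∈ w.left → A ∈ w.left) → (∀ A, box A ∈ v.left → box A ∈ w.left) → v = w)

theorem Rel.trans {u v w : World CL CR} (huv : Rel u v) (hvw : Rel v w) : Rel u w := by
  refine ⟨fun A hA => hvw.1 A (huv.1 A hA).1, fun hrefl hsub => ?_⟩
  obtain rfl := huv.2 hrefl fun A hA => hsub A (hvw.1 A hA).1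
  exact hvw.2 hrefl hsub

theorem Rel.antisymm {u v : World CL CR} (huv : Rel u v) (hvu : Rel v u) : u = v :=
  (huv.2 (fun A hA => (hvu.1 A (huv.1 A hA).1).2) fun A hA => (hvu.1 A hA).1).symm

theorem exists_rel_of_box_mem_right (hC : SearchClosed CL CR) {w : World CL CR} {A : Formula}
    (hA : box A ∈ w.right) : ∃ v, Rel w v ∧ A ∈ v.right := by
  by_cases hw : (∀ B, box B ∈ w.left → B ∈ w.left) ∧ box (imp A (box A)) ∈ w.left
  · refine ⟨w, ⟨fun B hB => ⟨hB, hw.1 B hB⟩, fun _ _ => rfl⟩, ?_⟩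
    exact (w.saturated.left_imp (hw.1 _ hw.2)).resolve_left fun h =>
      w.saturated.not_mem_right id h hA
  obtain ⟨M, N, hMN, hML, hLM, hRN⟩ := w.saturated.underivable
  obtain ⟨Γ, hΓ⟩ := exists_multiset_eq_add_map_box M
  obtain ⟨Δ, rfl⟩ := Multiset.exists_cons_of_mem (hRN _ hA id)
  have hACR : box A ∈ CR := Finset.mem_powerset.1 w.1.2.2 hA
  have hMC : ∀ B ∈ M, B ∈ CL := fun B hB => Finset.mem_powerset.1 w.1.1.2 (hML B hB)
  obtain ⟨L, R, hs, hL, hR, hL', hR'⟩ := exists_saturated hC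
    (box (imp A (box A)) ::ₘ boxtimes (M.filterMap unbox)) {A}
    (fun h => hMN (by rw [hΓ]; exact .boxGo _ _ _ _ _ h))
    (by
      intro B hB
      simp only [boxtimes, Multiset.mem_cons, Multiset.mem_add, Multiset.mem_map,
        mem_filterMap_unbox] at hB
      rcases hB with rfl | hB | ⟨D, hD, rfl⟩
      · exact (hC.right_box hACR).2
      · exact hC.left_box (hMC _ hB)
      · exact hMC _ hD)
    (by simpa using (hC.right_box hACR).1)
  refine ⟨⟨(⟨L, Finset.mem_powerset.2 hL⟩, ⟨R, Finset.mem_powerset.2 hR⟩), hs⟩,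
    ⟨fun B hB => ?_, fun hrefl hsub => ?_⟩, hR' A (by simp)⟩
  · have hBM : B ∈ M.filterMap unbox := mem_filterMap_unbox.2 (hLM _ hB id)
    exact ⟨hL' _ (Multiset.mem_cons_of_mem (Multiset.mem_add.2
        (Or.inr (Multiset.mem_map_of_mem _ hBM)))),
      hL' _ (Multiset.mem_cons_of_mem (Multiset.mem_add.2 (Or.inl hBM)))⟩
  · exact (hw ⟨hrefl, hsub _ (hL' _ (by simp))⟩).elim

theorem truth (hC : SearchClosed CL CR) (A : Formula) (w : World CL CR) :
    (A ∈ w.left → Forces Rel (fun w p => atom p ∈ w.left) w A) ∧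
      (A ∈ w.right → ¬ Forces Rel (fun w p => atom p ∈ w.left) w A) := by
  induction A generalizing w with
  | atom p => exact ⟨id, fun hR hL => w.saturated.not_mem_right id hL hR⟩
  | bot => exact ⟨w.saturated.bot_not_mem, fun _ => id⟩
  | imp A B ihA ihB =>
    refine ⟨fun h hA => ?_, fun h hAB => ?_⟩
    · exact (w.saturated.left_imp h).elim (ihB w).1 fun hR => ((ihA w).2 hR hA).elim
    · have := w.saturated.right_imp h
      exact (ihB w).2 this.2 (hAB ((ihA w).1 this.1))
  | box A ih =>
    refine ⟨fun h v hwv => (ih v).1 (hwv.1 A h).2, fun h hA => ?_⟩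
    obtain ⟨v, hwv, hv⟩ := exists_rel_of_box_mem_right hC h
    exact (ih v).2 hv (hA v hwv)

end World

theorem stmt1 (Γ Δ : Multiset Formula) : GoSeq true Γ Δ → GoSeq false Γ Δ := by
  intro h
  by_contra hcf
  obtain ⟨CL, CR, hC, hS⟩ := exists_searchClosed (Γ + Δ).toFinset
  have hΓ : ∀ A ∈ Γ, A ∈ CL := fun A hA => hC.subset (hS (by simp [hA]))
  have hΔ : ∀ A ∈ Δ, A ∈ CR := fun A hA => hS (by simp [hA])
  obtain ⟨L, R, hs, hL, hR, hΓL, hΔR⟩ := exists_saturated hC Γ Δ hcf hΓ hΔ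
  let w : World CL CR := ⟨(⟨L, Finset.mem_powerset.2 hL⟩, ⟨R, Finset.mem_powerset.2 hR⟩), hs⟩
  obtain ⟨B, hB, hwB⟩ := h.sound (R := World.Rel) (fun _ _ _ => World.Rel.trans)
    (fun _ _ => World.Rel.antisymm) (fun (w : World CL CR) p => atom p ∈ w.left) w
    fun A hA => (World.truth hC A w).1 (hΓL A hA)
  exact (World.truth hC B w).2 (hΔR B hB) hwB
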